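/- Let n ≥ 2 be an even integer and let m be a positive multiple of n. Then there exists a non-homotopic drawing in the plane with n vertices and m edges in which the number of crossing pairs of edges is less than m²/n. -/

import Mathlib

open unitInterval ENNReal

/-- A drawing in the plane with `n` vertices and `m` edges: a finite set `V ⊆ ℂ` of
`n` vertices together with continuous curves `f e : [0,1] → ℂ` whose endpoints are
vertices and whose interiors avoid the vertices. -/
structure PlaneDrawing (n m : ℕ) where
  V : Set ℂ
  finV : V.Finite
  cardV : V.ncard = n
  f : Fin m → I → ℂ
  cont : ∀ e, Continuous (f e)
  source_mem : ∀ e, f e 0 ∈ V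
  target_mem : ∀ e, f e 1 ∈ V
  interior_not_mem : ∀ e, ∀ t : I, t ≠ 0 → t ≠ 1 → f e t ∉ V

/-- Homotopy between two curves, fixing the endpoints of the first, with interior
avoiding the vertex set `V`. -/
def HomotopicIn (V : Set ℂ) (a b : I → ℂ) : Prop :=
  ∃ g : I × I → ℂ, Continuous g ∧
    (∀ t, g (0, t) = a t) ∧ (∀ t, g (1, t) = b t) ∧
    (∀ s, g (s, 0) = a 0) ∧ (∀ s, g (s, 1) = a 1) ∧
    (∀ s t : I, s ≠ 0 → s ≠ 1 → t ≠ 0 → t ≠ 1 → g (s, t) ∉ V)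

/-- Two edges are homotopic if one is homotopic to the other or to its reversal. -/
def EdgeHomotopic (V : Set ℂ) (a b : I → ℂ) : Prop :=
  HomotopicIn V a b ∨ HomotopicIn V (fun t => a (σ t)) b

/-- An edge is a trivial loop if it is homotopic to the constant map at its endpoint. -/
def IsTrivialLoop (V : Set ℂ) (a : I → ℂ) : Prop :=
  EdgeHomotopic V a fun _ => a 0

/-- A drawing is non-homotopic if no two distinct edges are homotopic and
no edge is a trivial loop. -/
def PlaneDrawing.NonHomotopic {n m : ℕ} (D : PlaneDrawing n m) : Prop :=
  (∀ e e' : Fin m, e ≠ e' → ¬ EdgeHomotopic D.V (D.f e) (D.f e')) ∧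
  (∀ e : Fin m, ¬ IsTrivialLoop D.V (D.f e))

/-- The crossing number: half the cardinality of the set of ordered crossings. -/
noncomputable def PlaneDrawing.crossingNumber {n m : ℕ} (D : PlaneDrawing n m) : ℝ≥0∞ :=
  (({p : (Fin m × I) × (Fin m × I) |
      p.1 ≠ p.2 ∧ p.1.2 ≠ 0 ∧ p.1.2 ≠ 1 ∧ p.2.2 ≠ 0 ∧ p.2.2 ≠ 1 ∧
      D.f p.1.1 p.1.2 = D.f p.2.1 p.2.2}).encard : ℝ≥0∞) / 2

/-- The set of ordered pairs of distinct edges that cross. -/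
def PlaneDrawing.crossingEdgePairs {n m : ℕ} (D : PlaneDrawing n m) : Set (Fin m × Fin m) :=
  {q | q.1 ≠ q.2 ∧ ∃ t t' : I, t ≠ 0 ∧ t ≠ 1 ∧ t' ≠ 0 ∧ t' ≠ 1 ∧ D.f q.1 t = D.f q.2 t'}

/-- Endpoints of logarithmic lifts are invariant under homotopies of curves avoiding `V`. -/
theorem HomotopicIn.exp_lift_end_eq {V : Set ℂ} {c : ℂ} (hc : c ∈ V) {A B : I → ℂ}
    (hA : Continuous A) (hB : Continuous B) (h0 : A 0 = B 0)
    (h : HomotopicIn V (fun t => c + Complex.exp (A t)) (fun t => c + Complex.exp (B t))) :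
    A 1 = B 1 := by
  obtain ⟨g, hg, hg0, hg1, hl, hr, hV⟩ := h
  have hne : ∀ x : I × I, g x - c ≠ 0 := by
    rintro ⟨s, t⟩
    have key : ∀ z : ℂ, c + Complex.exp z - c ≠ 0 := fun z => by simp [Complex.exp_ne_zero]
    by_cases hs0 : s = 0
    · rw [hs0, hg0]; exact key _
    by_cases hs1 : s = 1
    · rw [hs1, hg1]; exact key _
    by_cases ht0 : t = 0
    · rw [ht0, hl]; exact key _
    by_cases ht1 : t = 1
    · rw [ht1, hr]; exact key _
    intro hz
    exact hV s t hs0 hs1 ht0 ht1 (by rwa [sub_eq_zero.mp hz])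
  let p : C(ℂ, {z : ℂ // z ≠ 0}) := ⟨fun z => ⟨_, z.exp_ne_zero⟩, by fun_prop⟩
  let A' : C(I, ℂ) := ⟨A, hA⟩
  let B' : C(I, ℂ) := ⟨B, hB⟩
  have hcov : IsCoveringMap p := Complex.isCoveringMap_exp
  have H : (p.comp A').HomotopicRel (p.comp B') {0, 1} := by
    refine ⟨⟨⟨⟨fun x => ⟨g x - c, hne x⟩, by fun_prop⟩, fun t => ?_, fun t => ?_⟩, ?_⟩⟩
    · apply Subtype.ext
      simp [hg0, p, A']
    · apply Subtype.ext
      simp [hg1, p, B']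
    · rintro s t (rfl | rfl) <;> apply Subtype.ext
      · simp [hl, p, A']
      · simp [hr, p, A']
  obtain ⟨G⟩ := (hcov.homotopicRel_iff_comp ⟨0, by simp, h0⟩).mpr H
  have e1 := G.eq_fst 1 (x := (1 : I)) (by simp)
  have e2 := G.apply_one 1
  exact e1.symm.trans e2

/-- The exponent of a loop at `c + 1` that winds `k` times around `c`. -/
noncomputable def spiralExponent (k : ℤ) (t : I) : ℂ :=
  ((-((t : ℝ) * (1 - t)) : ℝ) : ℂ) + k * (t : ℝ) * (2 * Real.pi * Complex.I)

/-- A loop at `c + 1` that winds `k` times around `c` inside the unit disc about `c`. -/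
noncomputable def spiral (c : ℂ) (k : ℤ) (t : I) : ℂ :=
  c + Complex.exp (spiralExponent k t)

theorem continuous_spiralExponent (k : ℤ) : Continuous (spiralExponent k) := by
  unfold spiralExponent
  fun_prop

@[simp] theorem spiralExponent_zero (k : ℤ) : spiralExponent k 0 = 0 := by
  simp [spiralExponent]

@[simp] theorem spiralExponent_one (k : ℤ) :
    spiralExponent k 1 = k * (2 * Real.pi * Complex.I) := by
  simp [spiralExponent]

theorem spiral_zero (c : ℂ) (k : ℤ) : spiral c k 0 = c + 1 := by
  simp [spiral]

theorem spiral_one (c : ℂ) (k : ℤ) : spiral c k 1 = c + 1 := by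
  simp [spiral, Complex.exp_int_mul_two_pi_mul_I]

theorem spiral_ne (c : ℂ) (k : ℤ) (t : I) : spiral c k t ≠ c := by
  simp [spiral, Complex.exp_ne_zero]

theorem continuous_spiral (c : ℂ) (k : ℤ) : Continuous (spiral c k) := by
  have := continuous_spiralExponent k
  unfold spiral
  fun_prop

theorem norm_spiral_sub_lt_one (c : ℂ) (k : ℤ) {t : I} (h0 : t ≠ 0) (h1 : t ≠ 1) :
    ‖spiral c k t - c‖ < 1 := by
  have ht0 : (0 : ℝ) < t := unitInterval.pos_iff_ne_zero.mpr h0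
  have ht1 : (t : ℝ) < 1 := unitInterval.lt_one_iff_ne_one.mpr h1
  simp only [spiral, add_sub_cancel_left, Complex.norm_exp, Real.exp_lt_one_iff]
  simp [spiralExponent]
  nlinarith

theorem spiral_symm (c : ℂ) (k : ℤ) (t : I) : spiral c k (σ t) = spiral c (-k) t := by
  unfold spiral
  congr 1
  rw [Complex.exp_eq_exp_iff_exists_int]
  refine ⟨k, ?_⟩
  simp [spiralExponent]
  ring

theorem eq_of_spiral_homotopicIn {V : Set ℂ} {c : ℂ} (hc : c ∈ V) {k l : ℤ}
    (h : HomotopicIn V (spiral c k) (spiral c l)) : k = l := by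
  have := HomotopicIn.exp_lift_end_eq hc (continuous_spiralExponent k)
    (continuous_spiralExponent l) (by simp) h
  simpa [Real.pi_ne_zero] using this

theorem eq_zero_of_spiral_homotopicIn_const {V : Set ℂ} {c : ℂ} (hc : c ∈ V) {k : ℤ}
    (h : HomotopicIn V (spiral c k) fun _ => c + 1) : k = 0 := by
  rw [← Complex.exp_zero] at h
  have := HomotopicIn.exp_lift_end_eq hc (continuous_spiralExponent k)
    (continuous_const (y := 0)) (by simp) h
  simpa [Real.pi_ne_zero] using this

theorem HomotopicIn.source_eq {V : Set ℂ} {a b : I → ℂ} (h : HomotopicIn V a b) :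
    a 0 = b 0 := by
  obtain ⟨g, -, -, h1, hl, -⟩ := h
  rw [← h1 0, hl 1]

/-- The vertex set of `p` far apart pairs of vertices at distance `1`. -/
def pairVertices (p : ℕ) : Set ℂ :=
  Set.range fun x : Fin p × Fin 2 => ((4 * (x.1 : ℤ) + (x.2 : ℤ) : ℤ) : ℂ)

theorem ncard_pairVertices (p : ℕ) : (pairVertices p).ncard = p * 2 := by
  rw [pairVertices, Set.ncard_range_of_injective]
  · simp
  · rintro ⟨i, a⟩ ⟨j, b⟩ h
    have h' : 4 * (i : ℤ) + (a : ℤ) = 4 * (j : ℤ) + (b : ℤ) :=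
      Int.cast_injective (α := ℂ) h
    ext <;> simp <;> omega

theorem center_mem_pairVertices {p : ℕ} (j : Fin p) :
    ((4 * (j : ℤ) : ℤ) : ℂ) ∈ pairVertices p := ⟨(j, 0), by simp⟩

theorem center_add_one_mem_pairVertices {p : ℕ} (j : Fin p) :
    ((4 * (j : ℤ) : ℤ) : ℂ) + 1 ∈ pairVertices p := ⟨(j, 1), by simp⟩

theorem not_mem_pairVertices {p : ℕ} (j : Fin p) {z : ℂ} (hne : z ≠ ((4 * (j : ℤ) : ℤ) : ℂ))
    (hz : ‖z - ((4 * (j : ℤ) : ℤ) : ℂ)‖ < 1) : z ∉ pairVertices p := by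
  rintro ⟨⟨i, b⟩, rfl⟩
  rw [← Int.cast_sub, Complex.norm_intCast] at hz
  have hz' : |4 * (i : ℤ) + (b : ℤ) - 4 * (j : ℤ)| < 1 := by exact_mod_cast hz
  rw [Int.abs_lt_one_iff, sub_eq_zero] at hz'
  exact hne (by rw [← hz'])

theorem eq_of_norm_sub_lt_one {p : ℕ} {i j : Fin p} {z : ℂ}
    (hi : ‖z - ((4 * (i : ℤ) : ℤ) : ℂ)‖ < 1) (hj : ‖z - ((4 * (j : ℤ) : ℤ) : ℂ)‖ < 1) :
    i = j := by
  have h : ‖((4 * (j : ℤ) - 4 * (i : ℤ) : ℤ) : ℂ)‖ < 2 := by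
    have := norm_sub_le (z - ((4 * (i : ℤ) : ℤ) : ℂ)) (z - ((4 * (j : ℤ) : ℤ) : ℂ))
    rw [show ∀ a b : ℂ, z - a - (z - b) = b - a by intros; ring, ← Int.cast_sub] at this
    linarith
  rw [Complex.norm_intCast] at h
  have h' : |4 * (j : ℤ) - 4 * (i : ℤ)| < 2 := by exact_mod_cast h
  rw [abs_lt] at h'
  omega

/-- Edges are indexed by a pair of vertices and one less than the winding number. -/
noncomputable def spiralDrawing {m p r : ℕ} (φ : Fin m ≃ Fin p × Fin r) :
    PlaneDrawing (p * 2) m where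
  V := pairVertices p
  finV := Set.finite_range _
  cardV := ncard_pairVertices p
  f e := spiral ((4 * ((φ e).1 : ℤ) : ℤ) : ℂ) ((φ e).2 + 1)
  cont _ := continuous_spiral _ _
  source_mem e := by rw [spiral_zero]; exact center_add_one_mem_pairVertices _
  target_mem e := by rw [spiral_one]; exact center_add_one_mem_pairVertices _
  interior_not_mem _ _ h0 h1 :=
    not_mem_pairVertices _ (spiral_ne _ _ _) (norm_spiral_sub_lt_one _ _ h0 h1)

theorem spiralDrawing_nonHomotopic {m p r : ℕ} (φ : Fin m ≃ Fin p × Fin r) :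
    (spiralDrawing φ).NonHomotopic := by
  constructor
  · intro e e' hne h
    have hj : (φ e).1 = (φ e').1 := by
      have h0 : spiral ((4 * ((φ e).1 : ℤ) : ℤ) : ℂ) ((φ e).2 + 1) 0 =
          spiral ((4 * ((φ e').1 : ℤ) : ℤ) : ℂ) ((φ e').2 + 1) 0 := by
        rcases h with h | h
        · exact h.source_eq
        · have := h.source_eq
          simp only [unitInterval.symm_zero, spiralDrawing] at this
          rw [← this, spiral_zero, spiral_one]
      rw [spiral_zero, spiral_zero] at h0
      have h0' := Int.cast_injective (add_right_cancel h0)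
      omega
    have hk : (φ e).2 ≠ (φ e').2 := fun hk => hne (φ.injective (Prod.ext hj hk))
    simp only [EdgeHomotopic, spiralDrawing, spiral_symm, hj] at h
    rcases h with h | h <;>
      have := eq_of_spiral_homotopicIn (center_mem_pairVertices _) h <;> omega
  · intro e h
    simp only [IsTrivialLoop, EdgeHomotopic, spiralDrawing, spiral_symm, spiral_zero] at h
    rcases h with h | h <;>
      have := eq_zero_of_spiral_homotopicIn_const (center_mem_pairVertices _) h <;> omega

theorem spiralDrawing_ncard_crossingEdgePairs_lt {m p r : ℕ} (φ : Fin m ≃ Fin p × Fin r)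
    (hm : 0 < m) : (spiralDrawing φ).crossingEdgePairs.ncard < m * r := by
  set S := (spiralDrawing φ).crossingEdgePairs with hS
  have hfst : ∀ x ∈ S, (φ x.1).1 = (φ x.2).1 := by
    rintro x ⟨-, t, t', h0, h1, h0', h1', h⟩
    have h2 := norm_spiral_sub_lt_one ((4 * ((φ x.1).1 : ℤ) : ℤ) : ℂ) ((φ x.1).2 + 1) h0 h1
    have h3 := norm_spiral_sub_lt_one ((4 * ((φ x.2).1 : ℤ) : ℤ) : ℂ) ((φ x.2).2 + 1) h0' h1'
    simp only [spiralDrawing] at h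
    rw [h] at h2
    exact eq_of_norm_sub_lt_one h2 h3
  have hinj : Set.InjOn (fun x : Fin m × Fin m => (x.1, (φ x.2).2)) S := by
    rintro ⟨a, b⟩ hx ⟨c, d⟩ hy h
    obtain ⟨rfl, h⟩ := Prod.mk.inj h
    have : (φ b).1 = (φ d).1 := (hfst _ hx).symm.trans (hfst (a, d) hy)
    exact Prod.ext rfl (φ.injective (Prod.ext this h))
  have hss : (fun x : Fin m × Fin m => (x.1, (φ x.2).2)) '' S ⊂ Set.univ := by
    refine Set.ssubset_univ_iff.mpr fun h => ?_
    obtain ⟨⟨a, b⟩, hx, hab⟩ :=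
      h.symm.subset (Set.mem_univ ((⟨0, hm⟩ : Fin m), (φ ⟨0, hm⟩).2))
    obtain ⟨ha, hb⟩ := Prod.mk.inj hab
    simp only at ha hb
    subst ha
    exact hx.1 (φ.injective (Prod.ext (hfst _ hx) hb.symm))
  have := Set.ncard_lt_ncard hss
  rwa [hinj.ncard_image, Set.ncard_univ, Nat.card_prod, Nat.card_fin,
    Nat.card_fin] at this

/-- For every even `n ≥ 2` and every positive multiple `m` of `n`,
there is a non-homotopic drawing in the plane with `n` vertices and `m` edges having
fewer than `m²/n` (unordered) crossing pairs of edges. -/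
theorem few_crossing_pairs_construction (n m : ℕ) (hn : 2 ≤ n) (heven : Even n)
    (hm : 0 < m) (hdvd : n ∣ m) :
    ∃ D : PlaneDrawing n m, D.NonHomotopic ∧
      (D.crossingEdgePairs.ncard : ℝ) / 2 < (m : ℝ) ^ 2 / n := by
  obtain ⟨p, rfl⟩ := heven.two_dvd
  obtain ⟨q, rfl⟩ := hdvd
  rw [mul_comm 2 p] at *
  let φ : Fin (p * 2 * q) ≃ Fin p × Fin (2 * q) :=
    (finCongr (mul_assoc p 2 q)).trans finProdFinEquiv.symm
  refine ⟨spiralDrawing φ, spiralDrawing_nonHomotopic φ, ?_⟩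
  have h : ((spiralDrawing φ).crossingEdgePairs.ncard : ℝ) <
      ((p * 2 * q * (2 * q) : ℕ) : ℝ) :=
    Nat.cast_lt.mpr (spiralDrawing_ncard_crossingEdgePairs_lt φ hm)
  have hp : (p : ℝ) ≠ 0 := by
    intro hp
    simp_all
  push_cast at h ⊢
  rw [show ((p : ℝ) * 2 * q) ^ 2 / (p * 2) = p * 2 * q * (2 * q) / 2 by field_simp]
  linarith
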